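/- Let A be a circular matrix of order m×n, b ∈ ℤ^m with b ≥ 0, and x* ∈ Q(A,b). If every simple directed circuit in the weighted digraph D(A,x*) has nonnegative total cost, then x* ∈ Q*(A,b). -/

import Mathlib

namespace CircCover

attribute [local instance] Classical.propDecidable

/-- Membership in the circular interval `[a, a + k)ₙ` of `ZMod n`. -/
def inInterval {n : ℕ} (a : ZMod n) (k : ℕ) (j : ZMod n) : Prop :=
  ∃ s : ℕ, s < k ∧ j = a + (s : ZMod n)

/-- The `{0,1}`-matrix whose `i`-th row is the incidence vector of `[ℓ i, ℓ i + k i)ₙ`. -/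
noncomputable def circMatrix {m n : ℕ} (ℓ : Fin m → ZMod n) (k : Fin m → ℕ) :
    Matrix (Fin m) (ZMod n) ℝ :=
  fun i j => if inInterval (ℓ i) (k i) j then 1 else 0

/-- The condition `2 ≤ kᵢ ≤ n - 1` making `circMatrix ℓ k` a circular matrix. -/
def circBounds (n : ℕ) {m : ℕ} (k : Fin m → ℕ) : Prop :=
  ∀ i, 2 ≤ k i ∧ k i ≤ n - 1

/-- Arcs of the digraph `D(A)` associated with a circular matrix. -/
inductive Arc (m n : ℕ) : Type
  | fwdRow (i : Fin m)
  | fwdShort (j : ZMod n)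
  | revRow (i : Fin m)
  | revShort (j : ZMod n)
  deriving DecidableEq

namespace Arc

variable {m n : ℕ} (ℓ : Fin m → ZMod n) (k : Fin m → ℕ)

/-- The tail of an arc of `D(A)`. -/
def tail : Arc m n → ZMod n
  | fwdRow i => ℓ i - 1
  | fwdShort j => j - 1
  | revRow i => ℓ i + (k i : ZMod n) - 1
  | revShort j => j

/-- The head of an arc of `D(A)`. -/
def head : Arc m n → ZMod n
  | fwdRow i => ℓ i + (k i : ZMod n) - 1
  | fwdShort j => j
  | revRow i => ℓ i - 1
  | revShort j => j - 1

/-- The oriented length of an arc of `D(A)`. -/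
def len (k : Fin m → ℕ) : Arc m n → ℤ
  | fwdRow i => (k i : ℤ)
  | fwdShort _ => 1
  | revRow i => -(k i : ℤ)
  | revShort _ => -1

/-- Forward arcs. -/
def IsForward : Arc m n → Prop
  | fwdRow _ => True
  | fwdShort _ => True
  | _ => False

/-- Forward row arcs. -/
def IsFwdRow : Arc m n → Prop
  | fwdRow _ => True
  | _ => False

/-- Reverse row arcs. -/
def IsRevRow : Arc m n → Prop
  | revRow _ => True
  | _ => False

/-- Forward short arcs. -/
def IsFwdShort : Arc m n → Prop
  | fwdShort _ => True
  | _ => False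

/-- The arc jumps over node `j`. -/
def Jumps : Arc m n → ZMod n → Prop
  | fwdRow i, j => inInterval (ℓ i) (k i) j
  | fwdShort j', j => j' = j
  | revRow i, j => inInterval (ℓ i) (k i) j
  | revShort j', j => j' = j

end Arc

variable {m n : ℕ}

/-- A (not necessarily simple) closed directed path in `D(A)`, given as its list of arcs. -/
def IsClosedWalk (ℓ : Fin m → ZMod n) (k : Fin m → ℕ) (γ : List (Arc m n)) : Prop :=
  ∃ h : γ ≠ [],
    List.Chain' (fun a b => Arc.head ℓ k a = Arc.tail ℓ k b) γ ∧
      Arc.head ℓ k (γ.getLast h) = Arc.tail ℓ k (γ.head h)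

/-- A simple directed circuit in `D(A)`: a closed directed path visiting pairwise
distinct nodes. -/
def IsCircuit (ℓ : Fin m → ZMod n) (k : Fin m → ℕ) (γ : List (Arc m n)) : Prop :=
  IsClosedWalk ℓ k γ ∧ (γ.map (Arc.tail ℓ k)).Nodup

/-- The sum of the oriented lengths of the arcs of `γ`; it equals `p(γ) * n` where `p(γ)`
is the winding number. -/
def windingSum (k : Fin m → ℕ) (γ : List (Arc m n)) : ℤ :=
  (γ.map (Arc.len k)).sum

/-- `p⁺(γ, j)`: the number of forward arcs of `γ` jumping over `j`. -/
noncomputable def pPlus (ℓ : Fin m → ZMod n) (k : Fin m → ℕ) (γ : List (Arc m n))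
    (j : ZMod n) : ℕ :=
  γ.countP fun a => decide (Arc.IsForward a ∧ Arc.Jumps ℓ k a j)

/-- `p⁻(γ, j)`: the number of reverse arcs of `γ` jumping over `j`. -/
noncomputable def pMinus (ℓ : Fin m → ZMod n) (k : Fin m → ℕ) (γ : List (Arc m n))
    (j : ZMod n) : ℕ :=
  γ.countP fun a => decide (¬ Arc.IsForward a ∧ Arc.Jumps ℓ k a j)

/-- The number of (forward) row arcs of `γ` jumping over `j`. -/
noncomputable def rowJumpCount (ℓ : Fin m → ZMod n) (k : Fin m → ℕ) (γ : List (Arc m n))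
    (j : ZMod n) : ℕ :=
  γ.countP fun a => decide (Arc.IsFwdRow a ∧ Arc.Jumps ℓ k a j)

/-- The number of forward row arcs of `γ`. -/
def numRowArcs (γ : List (Arc m n)) : ℕ :=
  γ.countP fun a => match a with | Arc.fwdRow _ => true | _ => false

/-- `t(γ, b) = ∑_{aᵢ ∈ γ} bᵢ - ∑_{āᵢ ∈ γ} bᵢ`. -/
def tVal (b : Fin m → ℤ) (γ : List (Arc m n)) : ℤ :=
  (γ.map fun a => match a with
    | Arc.fwdRow i => b i
    | Arc.revRow i => -(b i)
    | _ => 0).sum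

/-- `t⁻(γ, b) = ∑_{āᵢ ∈ γ} bᵢ`. -/
def tMinusVal (b : Fin m → ℤ) (γ : List (Arc m n)) : ℤ :=
  (γ.map fun a => match a with
    | Arc.revRow i => b i
    | _ => 0).sum

/-- `β(γ, b) = ⌊t(γ, b) / p⌋`. -/
def betaVal (b : Fin m → ℤ) (γ : List (Arc m n)) (p : ℤ) : ℤ :=
  Int.fdiv (tVal b γ) p

/-- `r(γ, b) = t(γ, b) - β(γ, b) * p`. -/
def rVal (b : Fin m → ℤ) (γ : List (Arc m n)) (p : ℤ) : ℤ :=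
  tVal b γ - betaVal b γ p * p

/-- The `γ`-inequality `∑ⱼ (p⁻(γ,j) + r) xⱼ ≥ r (β + 1) + ∑_{āᵢ ∈ γ} bᵢ`. -/
def GammaIneqHolds [NeZero n] (ℓ : Fin m → ZMod n) (k : Fin m → ℕ) (b : Fin m → ℤ)
    (γ : List (Arc m n)) (p : ℤ) (x : ZMod n → ℝ) : Prop :=
  ∑ j : ZMod n, ((pMinus ℓ k γ j : ℝ) + (rVal b γ p : ℝ)) * x j ≥
    (rVal b γ p : ℝ) * ((betaVal b γ p : ℝ) + 1) + (tMinusVal b γ : ℝ)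

/-- The fractional covering polyhedron `Q(A, b) = {x ≥ 0 : A x ≥ b}`. -/
def Qpoly [NeZero n] (A : Matrix (Fin m) (ZMod n) ℝ) (b : Fin m → ℝ) :
    Set (ZMod n → ℝ) :=
  {x | (∀ j, 0 ≤ x j) ∧ ∀ i, b i ≤ ∑ j : ZMod n, A i j * x j}

/-- A point of `ℝⁿ` all whose coordinates are integers. -/
def IsIntegerPoint {n : ℕ} (x : ZMod n → ℝ) : Prop :=
  ∀ j, ∃ z : ℤ, x j = (z : ℝ)

/-- The covering polyhedron `Q*(A, b) = conv{x ∈ ℤⁿ : x ≥ 0, A x ≥ b}`. -/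
noncomputable def Qstar [NeZero n] (A : Matrix (Fin m) (ZMod n) ℝ) (b : Fin m → ℝ) :
    Set (ZMod n → ℝ) :=
  convexHull ℝ {x | IsIntegerPoint x ∧ x ∈ Qpoly A b}

/-- The slack of row `i` of `A` at the point `x`. -/
noncomputable def rowSlack [NeZero n] (ℓ : Fin m → ZMod n) (k : Fin m → ℕ)
    (b : Fin m → ℤ) (x : ZMod n → ℝ) (i : Fin m) : ℝ :=
  (∑ j : ZMod n, circMatrix ℓ k i j * x j) - (b i : ℝ)

/-- `μ = ⌈1ᵀ x⌉ - 1ᵀ x`. -/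
noncomputable def muVal [NeZero n] (x : ZMod n → ℝ) : ℝ :=
  (⌈∑ j : ZMod n, x j⌉ : ℝ) - ∑ j : ZMod n, x j

/-- Entry `i` of the last column `v` of `Ã` (the column indexed by `n ≡ 0`). -/
noncomputable def vRow (ℓ : Fin m → ZMod n) (k : Fin m → ℕ) (i : Fin m) : ℝ :=
  circMatrix ℓ k i 0

/-- Entry `m + j` of the last column `v` of `Ã`. -/
noncomputable def vShort (j : ZMod n) : ℝ :=
  if j = 0 then 1 else 0

/-- The cost of an arc in the weighted digraph `D(A, x)`: forward arcs carry the cost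
`c⁺ = μ (s* - (1 - μ) v)` and reverse arcs the cost `c⁻ = (1 - μ)(s* + μ v)`. -/
noncomputable def arcCost [NeZero n] (ℓ : Fin m → ZMod n) (k : Fin m → ℕ)
    (b : Fin m → ℤ) (x : ZMod n → ℝ) : Arc m n → ℝ
  | Arc.fwdRow i => muVal x * (rowSlack ℓ k b x i - (1 - muVal x) * vRow ℓ k i)
  | Arc.fwdShort j => muVal x * (x j - (1 - muVal x) * vShort j)
  | Arc.revRow i => (1 - muVal x) * (rowSlack ℓ k b x i + muVal x * vRow ℓ k i)
  | Arc.revShort j => (1 - muVal x) * (x j + muVal x * vShort j)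

/-- The cost `c(γ, x)` of a walk `γ` in `D(A, x)`. -/
noncomputable def walkCost [NeZero n] (ℓ : Fin m → ZMod n) (k : Fin m → ℕ)
    (b : Fin m → ℤ) (x : ZMod n → ℝ) (γ : List (Arc m n)) : ℝ :=
  (γ.map (arcCost ℓ k b x)).sum

/-- Row `i` dominates row `i'` of `A`. -/
def Dominates (A : Matrix (Fin m) (ZMod n) ℝ) (i i' : Fin m) : Prop :=
  i ≠ i' ∧ ∀ j, A i' j ≤ A i j

/-- `A` has no dominating rows. -/
def NoDominatingRows (A : Matrix (Fin m) (ZMod n) ℝ) : Prop :=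
  ∀ i i', ¬ Dominates A i i'

/-- The affine dimension of a subset of `ℝⁿ` (`-1` for the empty set). -/
noncomputable def adim [NeZero n] (S : Set (ZMod n → ℝ)) : ℤ :=
  if S = ∅ then -1 else (Module.finrank ℝ (affineSpan ℝ S).direction : ℤ)

/-- The valid inequality `aᵀ x ≥ α₀` defines a facet of `P`:
the face it defines has affine dimension `dim P - 1`. -/
def IsFacetIneq [NeZero n] (P : Set (ZMod n → ℝ)) (a : ZMod n → ℝ) (α₀ : ℝ) : Prop :=
  (∀ x ∈ P, α₀ ≤ ∑ j : ZMod n, a j * x j) ∧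
    adim {x ∈ P | ∑ j : ZMod n, a j * x j = α₀} = adim P - 1

/-- `j` is a node of the walk `γ`. -/
def IsNodeOf (ℓ : Fin m → ZMod n) (k : Fin m → ℕ) (γ : List (Arc m n)) (j : ZMod n) : Prop :=
  ∃ a ∈ γ, Arc.tail ℓ k a = j

/-- `j` is an essential bullet of `γ`: a node of `γ` which is neither a circle
(head of a forward short arc of `γ`) nor a cross (tail of a reverse short arc of `γ`). -/
def IsEssentialBullet (ℓ : Fin m → ZMod n) (k : Fin m → ℕ) (γ : List (Arc m n))
    (j : ZMod n) : Prop :=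
  IsNodeOf ℓ k γ j ∧ Arc.fwdShort j ∉ γ ∧ Arc.revShort j ∉ γ

/-- The number of essential bullets of `γ`. -/
noncomputable def numEssentialBullets [NeZero n] (ℓ : Fin m → ZMod n) (k : Fin m → ℕ)
    (γ : List (Arc m n)) : ℕ :=
  (Finset.univ.filter fun j : ZMod n => IsEssentialBullet ℓ k γ j).card

/-- `∑_{i ∈ F} a_{ij}`, the number of rows of `F` whose interval contains `j`. -/
noncomputable def rowCount (ℓ : Fin m → ZMod n) (k : Fin m → ℕ) (F : Finset (Fin m))
    (j : ZMod n) : ℕ :=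
  (F.filter fun i => inInterval (ℓ i) (k i) j).card

/-- The row family inequality induced by `F` (with `p* = max_j ∑_{i ∈ F} a_{ij} - 1`). -/
def RowFamilyIneqHolds [NeZero n] (ℓ : Fin m → ZMod n) (k : Fin m → ℕ)
    (F : Finset (Fin m)) (x : ZMod n → ℝ) : Prop :=
  let s := F.card
  let pstar := (Finset.univ.sup fun j : ZMod n => rowCount ℓ k F j) - 1
  let rstar := s - pstar * (s / pstar)
  ((rstar : ℝ) + 1) * ∑ j ∈ Finset.univ.filter (fun j : ZMod n => rowCount ℓ k F j = pstar + 1), x j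
    + (rstar : ℝ) * ∑ j ∈ Finset.univ.filter (fun j : ZMod n => rowCount ℓ k F j ≤ pstar), x j
    ≥ (rstar : ℝ) * (((s + pstar - 1) / pstar : ℕ) : ℝ)


section Potential

variable {V E : Type*} (tail head : E → V) (cost : E → ℝ)

/-- `γ` is a directed walk from `u` to `v`. -/
def IsWalk : V → List E → V → Prop
  | u, [], v => u = v
  | u, a :: γ, v => tail a = u ∧ IsWalk (head a) γ v

variable {tail head}

theorem isWalk_append {u v : V} {p q : List E} :
    IsWalk tail head u (p ++ q) v ↔
      ∃ w, IsWalk tail head u p w ∧ IsWalk tail head w q v := by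
  induction p generalizing u with
  | nil => simp [IsWalk]
  | cons a p ih => simp [IsWalk, ih, and_assoc]

theorem IsWalk.isChain {u v : V} {γ : List E} (h : IsWalk tail head u γ v) :
    γ.IsChain (fun a b => head a = tail b) := by
  induction γ generalizing u with
  | nil => exact .nil
  | cons a γ ih =>
    cases γ with
    | nil => exact .singleton a
    | cons c γ => exact .cons_cons h.2.1.symm (ih h.2)

theorem IsWalk.tail_head {u v : V} {γ : List E} (h : IsWalk tail head u γ v) (hγ : γ ≠ []) :
    tail (γ.head hγ) = u := by
  cases γ with
  | nil => exact absurd rfl hγ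
  | cons a γ => exact h.1

theorem IsWalk.head_getLast {u v : V} {γ : List E} (h : IsWalk tail head u γ v) (hγ : γ ≠ []) :
    head (γ.getLast hγ) = v := by
  induction γ generalizing u with
  | nil => exact absurd rfl hγ
  | cons a γ ih =>
    cases γ with
    | nil => exact h.2
    | cons c γ =>
      rw [List.getLast_cons (List.cons_ne_nil c γ)]
      exact ih h.2 _

theorem exists_split_of_not_nodup_map {f : E → V} {l : List E} (h : ¬ (l.map f).Nodup) :
    ∃ p a c d q, l = p ++ ((a :: c) ++ (d :: q)) ∧ f a = f d := by
  induction l with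
  | nil => simp at h
  | cons a l ih =>
    by_cases ha : f a ∈ l.map f
    · obtain ⟨d, hd, hda⟩ := List.mem_map.1 ha
      obtain ⟨c, q, rfl⟩ := List.append_of_mem hd
      exact ⟨[], a, c, d, q, by simp, hda.symm⟩
    · obtain ⟨p, a', c, d, q, rfl, hf⟩ := ih fun hn => h (List.nodup_cons.2 ⟨ha, hn⟩)
      exact ⟨a :: p, a', c, d, q, by simp, hf⟩

/-- A walk that repeats a node splits into a closed walk and a remaining walk. -/
theorem IsWalk.exists_split {u v : V} {γ : List E} (h : IsWalk tail head u γ v)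
    (hn : ¬ (γ.map tail).Nodup) :
    ∃ p c q w, γ = p ++ (c ++ q) ∧ c ≠ [] ∧ q ≠ [] ∧ IsWalk tail head w c w ∧
      IsWalk tail head u (p ++ q) v := by
  obtain ⟨p, a, c, d, q, rfl, hf⟩ := exists_split_of_not_nodup_map hn
  obtain ⟨w, hp, hw⟩ := isWalk_append.1 h
  obtain ⟨w', hc, hq⟩ := isWalk_append.1 hw
  have h1 : w = w' := hc.1.symm.trans (hf.trans hq.1)
  subst h1
  exact ⟨p, a :: c, d :: q, w, rfl, by simp, by simp, hc, isWalk_append.2 ⟨w, hp, hq⟩⟩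

theorem IsWalk.sum_nonneg_of_closed
    (hcost : ∀ u γ, γ ≠ [] → IsWalk tail head u γ u → (γ.map tail).Nodup →
      0 ≤ (γ.map cost).sum) {u : V} {γ : List E} (h : IsWalk tail head u γ u) :
    0 ≤ (γ.map cost).sum := by
  induction hN : γ.length using Nat.strong_induction_on generalizing u γ with
  | _ N ih =>
    by_cases hn : (γ.map tail).Nodup
    · by_cases hγ : γ = []
      · simp [hγ]
      · exact hcost u γ hγ h hn
    · obtain ⟨p, c, q, w, rfl, hc0, hq0, hc, hpq⟩ := h.exists_split hn
      have hlc := List.length_pos_of_ne_nil hc0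
      have hlq := List.length_pos_of_ne_nil hq0
      simp only [List.length_append] at hN
      have h1 := ih c.length (by omega) hc rfl
      have h2 := ih (p ++ q).length (by simp only [List.length_append]; omega) hpq rfl
      simp only [List.map_append, List.sum_append] at h2 ⊢
      linarith

theorem IsWalk.le_sum [Fintype V]
    (hcost : ∀ u γ, γ ≠ [] → IsWalk tail head u γ u → (γ.map tail).Nodup →
      0 ≤ (γ.map cost).sum) {C : ℝ} (hC0 : 0 ≤ C) (hC : ∀ a, -C ≤ cost a)
    {u v : V} {γ : List E} (h : IsWalk tail head u γ v) :
    -(Fintype.card V * C) ≤ (γ.map cost).sum := by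
  induction hN : γ.length using Nat.strong_induction_on generalizing γ with
  | _ N ih =>
    by_cases hn : (γ.map tail).Nodup
    · have hle : (γ.length : ℝ) ≤ Fintype.card V := by
        exact_mod_cast (by simpa using hn.length_le_card : γ.length ≤ Fintype.card V)
      have hs : (γ.map cost).length • (-C) ≤ (γ.map cost).sum :=
        List.card_nsmul_le_sum _ _ (by simpa using fun a _ => hC a)
      rw [List.length_map, nsmul_eq_mul] at hs
      nlinarith
    · obtain ⟨p, c, q, w, rfl, hc0, -, hc, hpq⟩ := h.exists_split hn
      have hlc := List.length_pos_of_ne_nil hc0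
      simp only [List.length_append] at hN
      have h1 := IsWalk.sum_nonneg_of_closed cost hcost hc
      have h2 := ih (p ++ q).length (by simp only [List.length_append]; omega) hpq rfl
      simp only [List.map_append, List.sum_append] at h2 ⊢
      linarith

/-- A finite weighted digraph without negative simple circuits has a feasible potential. -/
theorem exists_potential [Finite V] [Finite E]
    (hcost : ∀ u γ, γ ≠ [] → IsWalk tail head u γ u → (γ.map tail).Nodup →
      0 ≤ (γ.map cost).sum) :
    ∃ π : V → ℝ, ∀ a, π (head a) - π (tail a) ≤ cost a := by
  cases nonempty_fintype V
  obtain ⟨B, hB⟩ := (Set.finite_range cost).bddBelow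
  have hC : ∀ a, -|B| ≤ cost a := fun a => (neg_abs_le B).trans (hB ⟨a, rfl⟩)
  let S : V → Set ℝ := fun v => {r | ∃ u γ, IsWalk tail head u γ v ∧ (γ.map cost).sum = r}
  have hbdd : ∀ v, BddBelow (S v) := fun v =>
    ⟨-(Fintype.card V * |B|), by
      rintro _ ⟨u, γ, hγ, rfl⟩
      exact hγ.le_sum cost hcost (abs_nonneg B) hC⟩
  have hne : ∀ v, (S v).Nonempty := fun v => ⟨0, v, [], rfl, by simp⟩
  refine ⟨fun v => sInf (S v), fun a => ?_⟩
  rw [sub_le_iff_le_add, ← sub_le_iff_le_add']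
  refine le_csInf (hne _) ?_
  rintro _ ⟨u, γ, hγ, rfl⟩
  rw [sub_le_iff_le_add]
  exact csInf_le (hbdd _)
    ⟨u, γ ++ [a], isWalk_append.2 ⟨tail a, hγ, rfl, rfl⟩, by simp⟩

end Potential

section Rounding

open MeasureTheory

theorem intervalIntegrable_floor_add (y a c : ℝ) :
    IntervalIntegrable (fun θ : ℝ => (⌊y + θ⌋ : ℝ)) volume a c :=
  Monotone.intervalIntegrable fun _ _ h => Int.cast_le.2 (Int.floor_mono (by linarith))

/-- Randomised rounding preserves differences on average. -/
theorem integral_floor_add_sub_floor_add (u w : ℝ) :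
    ∫ θ in (0 : ℝ)..1, ((⌊u + θ⌋ : ℝ) - ⌊w + θ⌋) = u - w := by
  have hper : Function.Periodic (fun t : ℝ => t - (⌊t⌋ : ℝ)) 1 := fun t => by simp
  have hint : ∀ y : ℝ, ∫ θ in (0 : ℝ)..1, (⌊y + θ⌋ : ℝ) =
      y + 1 / 2 - ∫ t in (0 : ℝ)..1, (t - (⌊t⌋ : ℝ)) := by
    intro y
    have h := hper.intervalIntegral_add_eq y 0
    have hfloor : IntervalIntegrable (fun t : ℝ => (⌊t⌋ : ℝ)) volume y (y + 1) := by
      simpa using intervalIntegrable_floor_add 0 y (y + 1)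
    rw [intervalIntegral.integral_sub intervalIntegral.intervalIntegrable_id hfloor,
      zero_add, integral_id] at h
    rw [intervalIntegral.integral_comp_add_left (fun t : ℝ => (⌊t⌋ : ℝ)), ← h]
    simp only [add_zero]
    ring
  rw [intervalIntegral.integral_sub (intervalIntegrable_floor_add u 0 1)
    (intervalIntegrable_floor_add w 0 1), hint, hint]
  ring

end Rounding

theorem sum_circMatrix_mul [NeZero n] {ℓ : Fin m → ZMod n} {k : Fin m → ℕ} {i : Fin m}
    (hk : k i ≤ n) (z : ZMod n → ℝ) :
    ∑ j, circMatrix ℓ k i j * z j = ∑ s ∈ Finset.range (k i), z (ℓ i + s) := by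
  have hinj : Set.InjOn (fun s : ℕ => ℓ i + (s : ZMod n)) (Finset.range (k i)) := by
    intro s hs t ht hst
    have hs' : s < n := (Finset.mem_range.1 hs).trans_le hk
    have ht' : t < n := (Finset.mem_range.1 ht).trans_le hk
    have h := congrArg ZMod.val (add_left_cancel hst)
    rwa [ZMod.val_natCast_of_lt hs', ZMod.val_natCast_of_lt ht'] at h
  rw [← Finset.sum_image (f := z) hinj]
  simp only [circMatrix, ite_mul, one_mul, zero_mul]
  rw [← Finset.sum_filter]
  refine Finset.sum_congr ?_ fun _ _ => rfl
  ext j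
  rw [Finset.mem_filter, Finset.mem_image]
  simp [inInterval, eq_comm]

theorem sum_eq_sum_range [NeZero n] (z : ZMod n → ℝ) :
    ∑ j, z j = ∑ s ∈ Finset.range n, z (s : ZMod n) := by
  symm
  refine Finset.sum_nbij' (fun s : ℕ => (s : ZMod n)) ZMod.val ?_ ?_ ?_ ?_ ?_
  · simp
  · intro j _
    simpa using ZMod.val_lt j
  · intro s hs
    exact ZMod.val_natCast_of_lt (Finset.mem_range.1 hs)
  · intro j _
    exact ZMod.natCast_rightInverse j
  · simp

/-- A point of `Q(A, b)` whose coordinates have integer sum lies in `Q*(A, b)`. -/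
theorem mem_Qstar_of_sum_eq_intCast [NeZero n] {ℓ : Fin m → ZMod n} {k : Fin m → ℕ}
    (hk : ∀ i, k i ≤ n) {b : Fin m → ℤ} {x : ZMod n → ℝ}
    (hx : x ∈ Qpoly (circMatrix ℓ k) (fun i => (b i : ℝ))) {N : ℤ} (hN : ∑ j, x j = N) :
    x ∈ Qstar (circMatrix ℓ k) (fun i => (b i : ℝ)) := by
  let Y : ℕ → ℝ := fun t => ∑ s ∈ Finset.range t, x (s : ZMod n)
  have hYsucc : ∀ t, Y (t + 1) = Y t + x (t : ZMod n) := fun t => Finset.sum_range_succ _ _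
  have hYadd : ∀ a c, Y (a + c) = Y a + ∑ s ∈ Finset.range c, x ((a : ZMod n) + s) := by
    intro a c
    simp only [Y, Finset.sum_range_add, Nat.cast_add]
  have hYn : ∀ t, Y (t + n) = Y t + N := by
    intro t
    rw [add_comm t n, hYadd, ← hN, sum_eq_sum_range]
    simp only [CharP.cast_eq_zero, zero_add]
    exact add_comm _ _
  let F : ℝ → ℕ → ℤ := fun θ t => ⌊Y t + θ⌋
  have hFn : ∀ θ t, F θ (t + n) = F θ t + N := by
    intro θ t
    simp only [F, hYn]
    rw [add_right_comm, Int.floor_add_intCast]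
  have hFmul : ∀ θ t q, F θ (t + n * q) = F θ t + q * N := by
    intro θ t q
    induction q with
    | zero => simp
    | succ q ih =>
      rw [Nat.mul_succ, ← add_assoc, hFn, ih]
      push_cast
      ring
  let X : ℝ → ZMod n → ℝ := fun θ j => (F θ (j.val + 1) : ℝ) - F θ j.val
  have hXcast : ∀ θ (t : ℕ), X θ (t : ZMod n) = (F θ (t + 1) : ℝ) - F θ t := by
    intro θ t
    have h0 := hFmul θ (t % n) (t / n)
    have h1 := hFmul θ (t % n + 1) (t / n)
    rw [Nat.mod_add_div] at h0
    rw [add_right_comm, Nat.mod_add_div] at h1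
    simp only [X, ZMod.val_natCast, h0, h1]
    push_cast
    ring
  have hXint : ∀ θ j, ∃ z : ℤ, X θ j = z := fun θ j =>
    ⟨F θ (j.val + 1) - F θ j.val, by push_cast; rfl⟩
  have hXQ : ∀ θ, X θ ∈ Qpoly (circMatrix ℓ k) (fun i => (b i : ℝ)) := by
    intro θ
    refine ⟨fun j => ?_, fun i => ?_⟩
    · refine sub_nonneg.2 (Int.cast_le.2 (Int.floor_mono ?_))
      rw [hYsucc]
      linarith [hx.1 (j.val : ZMod n)]
    · have hrow := hx.2 i
      rw [sum_circMatrix_mul (hk i)] at hrow ⊢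
      have hval : ((ℓ i).val : ZMod n) = ℓ i := ZMod.natCast_rightInverse _
      have hY := hYadd (ℓ i).val (k i)
      rw [hval] at hY
      have hsum : ∑ s ∈ Finset.range (k i), X θ (ℓ i + s) =
          (F θ ((ℓ i).val + k i) : ℝ) - F θ (ℓ i).val := by
        have h := Finset.sum_range_sub (fun s => (F θ ((ℓ i).val + s) : ℝ)) (k i)
        rw [add_zero] at h
        rw [← h]
        refine Finset.sum_congr rfl fun s _ => ?_
        rw [← hval, ← Nat.cast_add, hXcast, hval]
        rfl
      rw [hsum]
      have hle : b i + F θ (ℓ i).val ≤ F θ ((ℓ i).val + k i) := by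
        simp only [F]
        rw [add_comm, ← Int.floor_add_intCast]
        refine Int.floor_mono ?_
        rw [hY]
        linarith
      have := (Int.cast_le (R := ℝ)).2 hle
      push_cast at this
      linarith
  have hXle : ∀ θ j, X θ j ≤ N := by
    intro θ j
    have h1 : ∑ j, X θ j = N := by
      have h0 := hFn θ 0
      rw [zero_add] at h0
      rw [sum_eq_sum_range, Finset.sum_congr rfl fun s _ => hXcast θ s,
        Finset.sum_range_sub (fun s => (F θ s : ℝ)), h0]
      push_cast
      ring
    rw [← h1]
    exact Finset.single_le_sum (fun j _ => (hXQ θ).1 j) (Finset.mem_univ j)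
  let S : Set (ZMod n → ℝ) := Set.range X
  have hSfin : S.Finite := by
    refine (Set.Finite.pi' fun _ : ZMod n =>
      (Set.finite_Icc (0 : ℤ) N).image (Int.cast : ℤ → ℝ)).subset ?_
    rintro _ ⟨θ, rfl⟩ j
    obtain ⟨z, hz⟩ := hXint θ j
    have h0 := (hXQ θ).1 j
    have h1 := hXle θ j
    rw [hz] at h0 h1
    exact ⟨z, ⟨by exact_mod_cast h0, by exact_mod_cast h1⟩, hz.symm⟩
  have hXI : ∀ j, MeasureTheory.IntegrableOn (fun θ => X θ j) (Set.Ioc 0 1) := fun j =>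
    ((intervalIntegrable_floor_add (Y (j.val + 1)) 0 1).sub
      (intervalIntegrable_floor_add (Y j.val) 0 1)).1
  have hprob : MeasureTheory.IsProbabilityMeasure
      (MeasureTheory.volume.restrict (Set.Ioc (0 : ℝ) 1)) := ⟨by simp⟩
  have hmem : ∫ θ in Set.Ioc (0 : ℝ) 1, X θ ∈ convexHull ℝ S :=
    (convex_convexHull ℝ S).integral_mem (hSfin.isClosed_convexHull ℝ)
      (.of_forall fun θ => subset_convexHull ℝ S ⟨θ, rfl⟩) (.of_eval hXI)
  have heq : ∫ θ in Set.Ioc (0 : ℝ) 1, X θ = x := by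
    ext j
    rw [MeasureTheory.eval_integral hXI, ← intervalIntegral.integral_of_le zero_le_one]
    refine (integral_floor_add_sub_floor_add (Y (j.val + 1)) (Y j.val)).trans ?_
    rw [hYsucc, add_sub_cancel_left, ZMod.natCast_rightInverse j]
  rw [heq] at hmem
  refine convexHull_mono ?_ hmem
  rintro _ ⟨θ, rfl⟩
  exact ⟨hXint θ, hXQ θ⟩

instance [NeZero n] : Finite (Arc m n) := by
  refine Finite.of_surjective
    (fun e : (Fin m ⊕ ZMod n) ⊕ (Fin m ⊕ ZMod n) =>
      e.elim (Sum.elim Arc.fwdRow Arc.fwdShort) (Sum.elim Arc.revRow Arc.revShort)) ?_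
  rintro (i | j | i | j)
  exacts [⟨.inl (.inl i), rfl⟩, ⟨.inl (.inr j), rfl⟩, ⟨.inr (.inl i), rfl⟩,
    ⟨.inr (.inr j), rfl⟩]

/-- If `x* ∈ Q(A, b)` and every simple directed circuit in `D(A, x*)`
has nonnegative total cost, then `x* ∈ Q*(A, b)`. -/
theorem mem_Qstar_of_nonneg_circuit_costs {m n : ℕ} [NeZero n] (ℓ : Fin m → ZMod n)
    (k : Fin m → ℕ) (hA : circBounds n k) (b : Fin m → ℤ) (hb : ∀ i, 0 ≤ b i)
    (x : ZMod n → ℝ) (hx : x ∈ Qpoly (circMatrix ℓ k) (fun i => (b i : ℝ)))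
    (hcost : ∀ γ : List (Arc m n), IsCircuit ℓ k γ → 0 ≤ walkCost ℓ k b x γ) :
    x ∈ Qstar (circMatrix ℓ k) (fun i => (b i : ℝ)) := by
  have hk : ∀ i, k i ≤ n := fun i => (hA i).2.trans (Nat.sub_le n 1)
  set f : ℝ := ∑ j, x j
  set μ : ℝ := muVal x
  have hμdef : μ = ⌈f⌉ - f := rfl
  have hμ0 : 0 ≤ μ := by linarith [Int.le_ceil f]
  have hμ1 : 0 < 1 - μ := by linarith [Int.ceil_lt_add_one f]
  rcases hμ0.eq_or_lt with hμz | hμpos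
  · exact mem_Qstar_of_sum_eq_intCast hk hx (N := ⌈f⌉) (by linarith)
  obtain ⟨π, hπ⟩ := exists_potential (tail := Arc.tail ℓ k) (head := Arc.head ℓ k)
    (arcCost ℓ k b x) fun u γ hγ hw hnd =>
      hcost γ ⟨⟨hγ, hw.isChain, (hw.head_getLast hγ).trans (hw.tail_head hγ).symm⟩, hnd⟩
  have hc : 0 < μ * (1 - μ) := mul_pos hμpos hμ1
  let w : ZMod n → ℝ := fun j => π j / (μ * (1 - μ))
  have hπw : ∀ j, π j = μ * (1 - μ) * w j := fun j => (mul_div_cancel₀ _ hc.ne').symm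
  let z : ZMod n → ℝ := fun j => vShort j + (w j - w (j - 1))
  have hfwd : ∀ {s v d : ℝ}, μ * (1 - μ) * d ≤ μ * (s - (1 - μ) * v) →
      0 ≤ s + -(1 - μ) * (v + d) := by
    intro s v d h
    rw [mul_assoc] at h
    linarith [le_of_mul_le_mul_left h hμpos]
  have hrev : ∀ {s v d : ℝ}, μ * (1 - μ) * (-d) ≤ (1 - μ) * (s + μ * v) →
      0 ≤ s + μ * (v + d) := by
    intro s v d h
    rw [mul_comm μ, mul_assoc] at h
    linarith [le_of_mul_le_mul_left h hμ1]
  have hzrow : ∀ i, ∑ j, circMatrix ℓ k i j * z j =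
      vRow ℓ k i + (w (ℓ i + (k i : ZMod n) - 1) - w (ℓ i - 1)) := by
    intro i
    simp only [z, mul_add, Finset.sum_add_distrib]
    congr 1
    · simp [vShort, vRow]
    · rw [sum_circMatrix_mul (hk i) fun j => w j - w (j - 1)]
      have h := Finset.sum_range_sub (fun s : ℕ => w (ℓ i + (s : ZMod n) - 1)) (k i)
      rw [Nat.cast_zero, add_zero] at h
      rw [← h]
      refine Finset.sum_congr rfl fun s _ => ?_
      push_cast
      rw [← add_assoc, add_sub_cancel_right]
  have hzsum : ∑ j, z j = 1 := by
    have h := Equiv.sum_comp (Equiv.subRight (1 : ZMod n)) w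
    simp only [Equiv.subRight_apply] at h
    simp [z, Finset.sum_add_distrib, h, vShort]
  have hshift : ∀ c : ℝ, (∀ j, 0 ≤ x j + c * z j) →
      (∀ i, 0 ≤ rowSlack ℓ k b x i + c * ∑ j, circMatrix ℓ k i j * z j) →
      ∀ N : ℤ, f + c = N →
      (x + c • z) ∈ Qstar (circMatrix ℓ k) (fun i => (b i : ℝ)) := by
    intro c hc1 hc2 N hN
    refine mem_Qstar_of_sum_eq_intCast hk (N := N) ⟨hc1, fun i => ?_⟩ ?_
    · have h := hc2 i
      simp only [rowSlack] at h
      simp only [Pi.add_apply, Pi.smul_apply, smul_eq_mul, mul_add, Finset.sum_add_distrib,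
        mul_left_comm _ c, ← Finset.mul_sum]
      linarith
    · simp only [Pi.add_apply, Pi.smul_apply, smul_eq_mul, Finset.sum_add_distrib,
        ← Finset.mul_sum, hzsum]
      linarith
  have hlow := hshift (-(1 - μ))
    (fun j => hfwd (by
      have h := hπ (Arc.fwdShort j)
      simp only [Arc.head, Arc.tail, arcCost, hπw] at h
      linarith))
    (fun i => by
      rw [hzrow]
      refine hfwd ?_
      have h := hπ (Arc.fwdRow i)
      simp only [Arc.head, Arc.tail, arcCost, hπw] at h
      linarith)
    (⌈f⌉ - 1) (by push_cast; linarith)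
  have hhigh := hshift μ
    (fun j => hrev (by
      have h := hπ (Arc.revShort j)
      simp only [Arc.head, Arc.tail, arcCost, hπw] at h
      linarith))
    (fun i => by
      rw [hzrow]
      refine hrev ?_
      have h := hπ (Arc.revRow i)
      simp only [Arc.head, Arc.tail, arcCost, hπw] at h
      linarith)
    ⌈f⌉ (by linarith)
  have hcomb : μ • (x + (-(1 - μ)) • z) + (1 - μ) • (x + μ • z) = x := by
    ext j
    simp only [Pi.add_apply, Pi.smul_apply, smul_eq_mul]
    ring
  rw [← hcomb]
  exact (convex_convexHull ℝ _) hlow hhigh hμ0 hμ1.le (by ring)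

end CircCover
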